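/- arXiv:1509.04747 — 4 statements merged into one kernel-verified Lean document; each statement's English description precedes it below -/
import Mathlib

section
/- Let ν > 0 and t > 0 be real numbers, and let Θ be a random variable uniformly distributed on [0, π]. Define W = √(ν² + t² − 2νt·cos Θ). Then the law of W is absolutely continuous with respect to Lebesgue measure, with density f_W(w) = (1/π)·(w/(νt))/√(1 − ((ν² + t² − w²)/(2νt))²) for |ν − t| < w < ν + t, and f_W(w) = 0 otherwise. -/
open MeasureTheory ProbabilityTheory Real

/-- Cosine-law distance density: if `Θ` is uniform on `[0, π]` and
`W = √(ν² + t² − 2νt cos Θ)`, then the law of `W` is absolutely continuous with density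
`f_W(w) = (1/π)·(w/(νt))/√(1 − ((ν² + t² − w²)/(2νt))²)` on `(|ν − t|, ν + t)` and `0` elsewhere. -/
theorem stmt_1 {Ω : Type*} [MeasureSpace Ω] [IsProbabilityMeasure (ℙ : Measure Ω)]
    (ν t : ℝ) (hν : 0 < ν) (ht : 0 < t)
    (Θ : Ω → ℝ)
    (hΘ : Measure.map Θ ℙ
      = (ENNReal.ofReal (1 / Real.pi)) • (volume.restrict (Set.Icc 0 Real.pi))) :
    Measure.map (fun ω => Real.sqrt (ν ^ 2 + t ^ 2 - 2 * ν * t * Real.cos (Θ ω))) ℙ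
      = volume.withDensity (fun w => ENNReal.ofReal
          (if |ν - t| < w ∧ w < ν + t then
            (1 / Real.pi) * (w / (ν * t))
              / Real.sqrt (1 - ((ν ^ 2 + t ^ 2 - w ^ 2) / (2 * ν * t)) ^ 2)
          else 0)) := by
  have hpi := Real.pi_pos
  have hνt : 0 < ν * t := mul_pos hν ht
  have hT : AEMeasurable Θ (ℙ : Measure Ω) := by
    by_contra h
    rw [Measure.map_of_not_aemeasurable h] at hΘ
    have h2 := congrArg (fun m : Measure ℝ => m Set.univ) hΘ
    simp [hpi.not_ge] at h2
  set g : ℝ → ℝ := fun θ => Real.sqrt (ν ^ 2 + t ^ 2 - 2 * ν * t * Real.cos θ) with hg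
  have hgm : Measurable g := by fun_prop
  have hmap : Measure.map (fun ω => Real.sqrt (ν ^ 2 + t ^ 2 - 2 * ν * t * Real.cos (Θ ω))) ℙ
      = Measure.map g (Measure.map Θ ℙ) :=
    (AEMeasurable.map_map_of_aemeasurable hgm.aemeasurable hT).symm
  rw [hmap, hΘ]
  set u : ℝ → ℝ := fun w => (ν ^ 2 + t ^ 2 - w ^ 2) / (2 * ν * t) with hu
  set I : Set ℝ := Set.Ioo |ν - t| (ν + t) with hI
  have hIpos : ∀ w ∈ I, 0 < w := fun w hw => (abs_nonneg _).trans_lt hw.1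
  have hu1 : ∀ w ∈ I, u w < 1 := by
    intro w hw
    have : (ν - t) ^ 2 < w ^ 2 := by
      rw [← sq_abs (ν - t)]
      exact pow_lt_pow_left₀ hw.1 (abs_nonneg _) (by norm_num)
    rw [hu]; simp only
    rw [div_lt_one (by positivity)]
    nlinarith
  have hu2 : ∀ w ∈ I, -1 < u w := by
    intro w hw
    have : w ^ 2 < (ν + t) ^ 2 := pow_lt_pow_left₀ hw.2 (hIpos w hw).le (by norm_num)
    rw [hu]; simp only
    rw [lt_div_iff₀ (by positivity)]
    nlinarith
  have hgh : ∀ w ∈ I, g (Real.arccos (u w)) = w := by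
    intro w hw
    simp only [hg]
    rw [Real.cos_arccos (hu2 w hw).le (hu1 w hw).le]
    have : ν ^ 2 + t ^ 2 - 2 * ν * t * u w = w ^ 2 := by
      simp only [hu]; field_simp; ring
    rw [this, Real.sqrt_sq (hIpos w hw).le]
  have hhg : ∀ θ ∈ Set.Ioo 0 Real.pi, g θ ∈ I ∧ Real.arccos (u (g θ)) = θ := by
    intro θ hθ
    have hc1 : Real.cos θ < 1 := by
      have := Real.cos_lt_cos_of_nonneg_of_le_pi le_rfl hθ.2.le hθ.1
      simpa using this
    have hc2 : -1 < Real.cos θ := by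
      have := Real.cos_lt_cos_of_nonneg_of_le_pi hθ.1.le le_rfl hθ.2
      simpa using this
    have h1 : 0 < (1 - Real.cos θ) * (ν * t) := mul_pos (by linarith) hνt
    have h2 : 0 < (1 + Real.cos θ) * (ν * t) := mul_pos (by linarith) hνt
    have h0 : 0 ≤ ν ^ 2 + t ^ 2 - 2 * ν * t * Real.cos θ := by nlinarith [sq_nonneg (ν - t)]
    refine ⟨⟨?_, ?_⟩, ?_⟩
    · apply Real.lt_sqrt_of_sq_lt
      rw [sq_abs]; nlinarith
    · simp only [hg]
      rw [Real.sqrt_lt' (by positivity)]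
      nlinarith
    · have : u (g θ) = Real.cos θ := by
        simp only [hu, hg]
        rw [Real.sq_sqrt h0]; field_simp; ring
      rw [this, Real.arccos_cos hθ.1.le hθ.2.le]
  ext A hA
  rw [Measure.map_apply hgm hA, withDensity_apply _ hA, Measure.smul_apply,
    Measure.restrict_apply (hgm hA)]
  have hAI : MeasurableSet (A ∩ I) := hA.inter measurableSet_Ioo
  have himg : (fun w => Real.arccos (u w)) '' (A ∩ I) = g ⁻¹' A ∩ Set.Ioo 0 Real.pi := by
    ext θ
    constructor
    · rintro ⟨w, ⟨hwA, hwI⟩, rfl⟩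
      refine ⟨?_, Real.arccos_pos.2 (hu1 w hwI), ?_⟩
      · simpa [Set.mem_preimage, hgh w hwI] using hwA
      · refine lt_of_le_of_ne (Real.arccos_le_pi _) fun h => ?_
        exact absurd (Real.arccos_eq_pi.1 h) (not_le.2 (hu2 w hwI))
    · rintro ⟨hA', hθ⟩
      exact ⟨g θ, ⟨hA', (hhg θ hθ).1⟩, (hhg θ hθ).2⟩
  have hinj : Set.InjOn (fun w => Real.arccos (u w)) (A ∩ I) := by
    intro a ha b hb hab
    have := congrArg g hab
    simpa [hgh a ha.2, hgh b hb.2] using this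
  have hder : ∀ w ∈ A ∩ I, HasDerivWithinAt (fun w => Real.arccos (u w))
      ((w / (ν * t)) / Real.sqrt (1 - (u w) ^ 2)) (A ∩ I) w := by
    intro w hw
    have h1 : HasDerivAt u (-(2 * w) / (2 * ν * t)) w := by
      have := ((hasDerivAt_pow 2 w).const_sub (ν ^ 2 + t ^ 2)).div_const (2 * ν * t)
      simpa using this
    have h2 := (Real.hasDerivAt_arccos (hu2 w hw.2).ne' (hu1 w hw.2).ne).comp w h1
    refine (h2.congr_deriv ?_).hasDerivWithinAt
    have : 0 < Real.sqrt (1 - (u w) ^ 2) := by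
      apply Real.sqrt_pos.2
      nlinarith [hu1 w hw.2, hu2 w hw.2]
    field_simp
  have key := lintegral_image_eq_lintegral_abs_deriv_mul hAI hder hinj (fun _ => 1)
  rw [himg] at key
  simp only [mul_one, lintegral_const, one_mul, Measure.restrict_apply_univ] at key
  have hvol : volume (g ⁻¹' A ∩ Set.Icc 0 Real.pi) = volume (g ⁻¹' A ∩ Set.Ioo 0 Real.pi) :=
    measure_congr (Filter.EventuallyEq.inter (ae_eq_refl _) Ioo_ae_eq_Icc.symm)
  rw [hvol, key, smul_eq_mul, ← lintegral_const_mul' _ _ ENNReal.ofReal_ne_top]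
  rw [Set.inter_comm A I, ← Measure.restrict_restrict measurableSet_Ioo,
    ← lintegral_indicator measurableSet_Ioo]
  apply lintegral_congr
  intro w
  by_cases hw : w ∈ I
  · have hw' : |ν - t| < w ∧ w < ν + t := hw
    have := hIpos w hw
    rw [Set.indicator_of_mem hw, if_pos hw', ← ENNReal.ofReal_mul (by positivity),
      abs_of_nonneg (by positivity), mul_div_assoc]
  · have hw' : ¬ (|ν - t| < w ∧ w < ν + t) := hw
    rw [Set.indicator_of_notMem hw, if_neg hw', ENNReal.ofReal_zero]
end

section
/- Let σ > 0, let X = (X₁, X₂) be a centered 2D Gaussian random vector with parameter σ, and let s ∈ ℝ² with t = ‖s‖ (Euclidean norm). Then the law of the random variable R = ‖X + s‖ is absolutely continuous with respect to Lebesgue measure, with density f_R(r) = (r/σ²)·exp(−(r² + t²)/(2σ²))·I₀(rt/σ²) for r > 0 and 0 for r ≤ 0; that is, R is Rician distributed with parameters t and σ. -/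
open MeasureTheory ProbabilityTheory Real

/-- Integral representation of the modified Bessel function of the first kind of order zero. -/
noncomputable def besselI0 (x : ℝ) : ℝ :=
  (1 / (2 * Real.pi)) * ∫ θ in (0 : ℝ)..(2 * Real.pi), Real.exp (x * Real.cos θ)

/-- `X` is a centered 2D Gaussian random vector with parameter `σ`: its two coordinates are
independent real Gaussians with mean `0` and variance `σ²`. -/
def IsCenteredGaussian2D {Ω : Type*} [MeasureSpace Ω] (σ : ℝ)
    (X : Ω → EuclideanSpace ℝ (Fin 2)) : Prop :=
  (∀ i : Fin 2, Measure.map (fun ω => X ω i) ℙ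
      = ProbabilityTheory.gaussianReal 0 ⟨σ ^ 2, sq_nonneg σ⟩) ∧
  ProbabilityTheory.IndepFun (fun ω => X ω 0) (fun ω => X ω 1) ℙ

lemma bessel_aux (c a b : ℝ) :
    ∫ θ in (-π)..π, Real.exp (c * (a * cos θ + b * sin θ))
      = 2 * π * besselI0 (c * √(a ^ 2 + b ^ 2)) := by
  set z : ℂ := ⟨a, b⟩ with hz
  have hn : ‖z‖ = √(a ^ 2 + b ^ 2) := by
    rw [Complex.norm_def, Complex.normSq_apply]; simp [hz, sq]
  have ha : ‖z‖ * cos z.arg = a := by simp [hz, Complex.norm_mul_cos_arg]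
  have hb : ‖z‖ * sin z.arg = b := by simp [hz, Complex.norm_mul_sin_arg]
  have h1 : ∀ θ, Real.exp (c * (a * cos θ + b * sin θ))
      = (fun u => Real.exp (c * ‖z‖ * cos u)) (θ - z.arg) := by
    intro θ
    simp only [cos_sub]
    congr 1
    conv_lhs => rw [← ha, ← hb]
    ring
  have hper : Function.Periodic (fun u => Real.exp (c * ‖z‖ * cos u)) (2 * π) := by
    intro u; simp
  simp_rw [h1]
  rw [intervalIntegral.integral_comp_sub_right (fun u => Real.exp (c * ‖z‖ * cos u))]
  have h2 := hper.intervalIntegral_add_eq (-π - z.arg) 0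
  rw [show π - z.arg = -π - z.arg + 2 * π by ring, h2, besselI0, ← hn, zero_add]
  field_simp

lemma pdf_aux (σ : ℝ) (hσ : 0 < σ) (v : NNReal) (hvσ : (v : ℝ) = σ ^ 2) (a b r θ : ℝ) :
    gaussianPDFReal a v (r * cos θ)
      * gaussianPDFReal b v (r * sin θ)
    = (1 / (2 * π * σ ^ 2) * Real.exp (-(r ^ 2 + (a ^ 2 + b ^ 2)) / (2 * σ ^ 2)))
      * Real.exp (r / σ ^ 2 * (a * cos θ + b * sin θ)) := by
  simp only [gaussianPDFReal, hvσ]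
  have h : (√(2 * π * σ ^ 2))⁻¹ * (√(2 * π * σ ^ 2))⁻¹ = 1 / (2 * π * σ ^ 2) := by
    rw [← mul_inv, Real.mul_self_sqrt (by positivity), one_div]
  rw [mul_mul_mul_comm, h, mul_assoc (1 / (2 * π * σ ^ 2)), ← Real.exp_add, ← Real.exp_add]
  congr 2
  field_simp
  have := sin_sq_add_cos_sq θ
  linear_combination (-(r^2)) * this

lemma inner_aux (σ : ℝ) (hσ : 0 < σ) (v : NNReal) (hvσ : (v : ℝ) = σ ^ 2) (a b r : ℝ) (hr : 0 < r) :
    ∫⁻ θ in Set.Ioo (-π) π, ENNReal.ofReal r *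
      (gaussianPDF a v (r * cos θ)
      * gaussianPDF b v (r * sin θ))
    = ENNReal.ofReal ((r / σ ^ 2) * Real.exp (-(r ^ 2 + (a ^ 2 + b ^ 2)) / (2 * σ ^ 2))
              * besselI0 (r * √(a ^ 2 + b ^ 2) / σ ^ 2)) := by
  have h1 : ∀ θ, ENNReal.ofReal r *
      (gaussianPDF a v (r * cos θ)
      * gaussianPDF b v (r * sin θ))
      = ENNReal.ofReal (r * ((1 / (2 * π * σ ^ 2) *
          Real.exp (-(r ^ 2 + (a ^ 2 + b ^ 2)) / (2 * σ ^ 2)))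
      * Real.exp (r / σ ^ 2 * (a * cos θ + b * sin θ)))) := by
    intro θ
    rw [← pdf_aux σ hσ v hvσ, gaussianPDF, gaussianPDF, ENNReal.ofReal_mul hr.le,
      ENNReal.ofReal_mul (gaussianPDFReal_nonneg _ _ _)]
  simp_rw [h1]
  rw [← ofReal_integral_eq_lintegral_ofReal]
  · congr 1
    rw [← integral_Ioc_eq_integral_Ioo, ← intervalIntegral.integral_of_le (by linarith [pi_pos]),
      intervalIntegral.integral_const_mul, intervalIntegral.integral_const_mul, bessel_aux]
    rw [show r / σ ^ 2 * √(a ^ 2 + b ^ 2) = r * √(a ^ 2 + b ^ 2) / σ ^ 2 by ring]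
    field_simp
  · apply (Continuous.integrableOn_Icc (a := -π) (b := π) (by fun_prop)).mono_set
    exact Set.Ioo_subset_Icc_self
  · exact Filter.Eventually.of_forall fun θ => by positivity

lemma law_aux (σ : ℝ) (hσ : 0 < σ) (v : NNReal) (hvσ : (v : ℝ) = σ ^ 2) (a b : ℝ) :
    Measure.map (fun p : ℝ × ℝ => √(p.1 ^ 2 + p.2 ^ 2))
      ((gaussianReal a v).prod (gaussianReal b v))
    = volume.withDensity (fun r => ENNReal.ofReal
          (if 0 < r then
            (r / σ ^ 2) * Real.exp (-(r ^ 2 + (a ^ 2 + b ^ 2)) / (2 * σ ^ 2))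
              * besselI0 (r * √(a ^ 2 + b ^ 2) / σ ^ 2)
          else 0)) := by
  have hv : v ≠ 0 := by
    rintro rfl
    have : 0 < σ ^ 2 := by positivity
    rw [← hvσ] at this
    simp at this
  have hg : Measurable (fun p : ℝ × ℝ => √(p.1 ^ 2 + p.2 ^ 2)) := by fun_prop
  ext A hA
  rw [gaussianReal_of_var_ne_zero _ hv, gaussianReal_of_var_ne_zero _ hv,
    prod_withDensity (measurable_gaussianPDF _ _) (measurable_gaussianPDF _ _),
    Measure.map_apply hg hA, withDensity_apply _ (hg hA), withDensity_apply _ hA,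
    ← lintegral_indicator (hg hA), ← Measure.volume_eq_prod, ← lintegral_comp_polarCoord_symm,
    polarCoord_target, Measure.volume_eq_prod, ← Measure.prod_restrict, lintegral_prod]
  · rw [← lintegral_indicator hA, ← lintegral_indicator measurableSet_Ioi]
    congr 1
    ext r
    by_cases hr : 0 < r
    · rw [Set.indicator_of_mem (show r ∈ Set.Ioi 0 from hr)]
      have hs : ∀ θ, √((r * cos θ) ^ 2 + (r * sin θ) ^ 2) = r := by
        intro θ
        rw [show (r * cos θ) ^ 2 + (r * sin θ) ^ 2 = r ^ 2 * (sin θ ^ 2 + cos θ ^ 2) by ring,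
          sin_sq_add_cos_sq, mul_one, sqrt_sq hr.le]
      by_cases hrA : r ∈ A
      · rw [Set.indicator_of_mem hrA, if_pos hr, ← inner_aux σ hσ v hvσ a b r hr]
        congr 1
        ext θ
        rw [Set.indicator_of_mem (by simpa [hs] using hrA)]
        simp
      · rw [Set.indicator_of_notMem hrA]
        rw [← lintegral_zero (μ := volume.restrict (Set.Ioo (-π) π))]
        congr 1
        ext θ
        rw [Set.indicator_of_notMem (by simpa [hs] using hrA)]
        simp
    · rw [Set.indicator_of_notMem (show r ∉ Set.Ioi 0 from hr)]
      simp [Set.indicator, hr]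
  · have h2 : Measurable fun p : ℝ × ℝ =>
        gaussianPDF a v p.1 * gaussianPDF b v p.2 :=
      ((measurable_gaussianPDF _ _).comp measurable_fst).mul
        ((measurable_gaussianPDF _ _).comp measurable_snd)
    exact ((measurable_fst.ennreal_ofReal).mul
      ((h2.indicator (hg hA)).comp continuous_polarCoord_symm.measurable)).aemeasurable

/-- Rician distance density: if `X` is a centered 2D Gaussian with parameter
`σ` and `s ∈ ℝ²` with `t = ‖s‖`, then `R = ‖X + s‖` has density
`(r/σ²)·exp(−(r² + t²)/(2σ²))·I₀(rt/σ²)` for `r > 0` and `0` for `r ≤ 0`. -/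
theorem stmt_3 {Ω : Type*} [MeasureSpace Ω] [IsProbabilityMeasure (ℙ : Measure Ω)]
    (σ : ℝ) (hσ : 0 < σ)
    (X : Ω → EuclideanSpace ℝ (Fin 2)) (hX : IsCenteredGaussian2D σ X)
    (s : EuclideanSpace ℝ (Fin 2)) :
    Measure.map (fun ω => ‖X ω + s‖) ℙ
      = volume.withDensity (fun r => ENNReal.ofReal
          (if 0 < r then
            (r / σ ^ 2) * Real.exp (-(r ^ 2 + ‖s‖ ^ 2) / (2 * σ ^ 2))
              * besselI0 (r * ‖s‖ / σ ^ 2)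
          else 0)) := by
  obtain ⟨hm0, hi⟩ := hX
  obtain ⟨v, hv, hm⟩ : ∃ v : NNReal, (v : ℝ) = σ ^ 2 ∧
      ∀ i : Fin 2, Measure.map (fun ω => X ω i) (ℙ : Measure Ω) = gaussianReal 0 v :=
    ⟨⟨σ ^ 2, sq_nonneg σ⟩, rfl, hm0⟩
  have hae : ∀ i, AEMeasurable (fun ω => X ω i) (ℙ : Measure Ω) := by
    intro i
    apply AEMeasurable.of_map_ne_zero
    rw [hm i]
    exact IsProbabilityMeasure.ne_zero _
  have hs : ‖s‖ = √(s 0 ^ 2 + s 1 ^ 2) := by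
    rw [EuclideanSpace.norm_eq]; simp [Fin.sum_univ_two]
  have hs2 : ‖s‖ ^ 2 = s 0 ^ 2 + s 1 ^ 2 := by rw [hs, sq_sqrt (by positivity)]
  have hadd : ∀ c : ℝ, Measurable (fun x : ℝ => x + c) := fun c => by fun_prop
  have hi' : IndepFun (fun ω => X ω 0 + s 0) (fun ω => X ω 1 + s 1) (ℙ : Measure Ω) :=
    hi.comp (hadd (s 0)) (hadd (s 1))
  have hae' : ∀ i, AEMeasurable (fun ω => X ω i + s i) (ℙ : Measure Ω) :=
    fun i => (hae i).add_const _
  have hm' : ∀ i, Measure.map (fun ω => X ω i + s i) (ℙ : Measure Ω)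
      = gaussianReal (s i) v := by
    intro i
    have := AEMeasurable.map_map_of_aemeasurable (hadd (s i)).aemeasurable (hae i)
    rw [hm i, gaussianReal_map_add_const, zero_add] at this
    exact this.symm
  have hj := (indepFun_iff_map_prod_eq_prod_map_map (hae' 0) (hae' 1)).1 hi'
  rw [hm', hm'] at hj
  have hl := law_aux σ hσ v hv (s 0) (s 1)
  rw [← hj, AEMeasurable.map_map_of_aemeasurable
    (by fun_prop) ((hae' 0).prodMk (hae' 1)), ← hs, ← hs2] at hl
  rw [← hl]
  congr 1
  ext ω
  rw [EuclideanSpace.norm_eq]; simp [Fin.sum_univ_two]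
end

section
/- Let σ > 0, let X be a centered 2D Gaussian random vector with parameter σ, and let s, s' ∈ ℝ² with ‖s‖ ≤ ‖s'‖. Then ‖X + s‖ is stochastically dominated by ‖X + s'‖; that is, for every r ≥ 0, P(‖X + s'‖ ≤ r) ≤ P(‖X + s‖ ≤ r). -/
open MeasureTheory ProbabilityTheory Real

open InnerProductSpace in
lemma reflect_norm_le {E : Type*} [NormedAddCommGroup E] [InnerProductSpace ℝ E]
    (a a' z : E) (h : ‖a‖ ≤ ‖a'‖) (hz : ‖z - a'‖ ≤ ‖z - a‖) :
    ‖a + (Submodule.reflection (Submodule.span ℝ {a' - a})ᗮ) (z - a')‖ ≤ ‖z‖ := by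
  by_cases hv : a' - a = 0
  · have : a' = a := sub_eq_zero.mp hv
    subst this
    have h2 : Submodule.reflection (Submodule.span ℝ {a' - a'})ᗮ (z - a') = z - a' := by
      apply Submodule.reflection_mem_subspace_eq_self
      simp
    rw [h2]; simp
  rw [Submodule.reflection_orthogonal_apply, Submodule.reflection_singleton_apply]
  have hn : ‖a' - a‖ ^ 2 ≠ 0 := by positivity
  set v := a' - a with hvdef
  set c : ℝ := ⟪v, z - a'⟫_ℝ / ‖v‖ ^ 2 with hc
  have hcv : c * ‖v‖ ^ 2 = ⟪v, z - a'⟫_ℝ := by rw [hc]; field_simp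
  have e1 : a + -((2 : ℕ) • (⟪v, z - a'⟫_ℝ / ((‖v‖ : ℝ) ^ 2)) • v - (z - a'))
      = z - (1 + 2 * c) • v := by
    rw [← hc, hvdef]; module
  have e0 : z - a = (z - a') + v := by rw [hvdef]; abel
  have i1 : ‖z - a'‖ ^ 2 ≤ ‖z - a‖ ^ 2 := by gcongr
  rw [e0, norm_add_sq_real, real_inner_comm, ← hcv] at i1
  have hvpos : 0 < ‖v‖ ^ 2 := by positivity
  have hd : 0 ≤ 1 + 2 * c := by
    by_contra hneg
    push Not at hneg
    nlinarith
  have i2 : ‖a‖ ^ 2 ≤ ‖a'‖ ^ 2 := by gcongr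
  have e2 : a = a' - v := by rw [hvdef]; abel
  rw [e2, norm_sub_sq_real, real_inner_comm] at i2
  have e3 : ⟪v, z - a'⟫_ℝ = ⟪v, z⟫_ℝ - ⟪v, a'⟫_ℝ := inner_sub_right _ _ _
  refine le_of_sq_le_sq ?_ (norm_nonneg _)
  erw [e1]
  rw [norm_sub_sq_real, inner_smul_right, norm_smul, real_inner_comm, mul_pow, norm_eq_abs, sq_abs]
  nlinarith [mul_nonneg hd (show 0 ≤ 2 * ⟪v, a'⟫_ℝ - ‖v‖ ^ 2 by linarith)]

lemma main_withDensity (f : EuclideanSpace ℝ (Fin 2) → ENNReal) (hf : Measurable f)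
    (hmono : ∀ z w, ‖w‖ ≤ ‖z‖ → f z ≤ f w)
    (a a' : EuclideanSpace ℝ (Fin 2)) (h : ‖a‖ ≤ ‖a'‖) (r : ℝ) :
    (volume.withDensity f) {z | ‖z - a'‖ ≤ r} ≤ (volume.withDensity f) {z | ‖z - a‖ ≤ r} := by
  set B : Set (EuclideanSpace ℝ (Fin 2)) := {z | ‖z - a‖ ≤ r} with hB
  set B' : Set (EuclideanSpace ℝ (Fin 2)) := {z | ‖z - a'‖ ≤ r} with hB'
  have mB : MeasurableSet B := measurableSet_le (by fun_prop) (by fun_prop)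
  have mB' : MeasurableSet B' := measurableSet_le (by fun_prop) (by fun_prop)
  set L := Submodule.reflection (Submodule.span ℝ {a' - a})ᗮ with hL
  set R : EuclideanSpace ℝ (Fin 2) → EuclideanSpace ℝ (Fin 2) := fun z => a + L (z - a') with hR
  have hRmp : MeasurePreserving R volume volume :=
    (measurePreserving_add_left volume a).comp
      (L.measurePreserving.comp (measurePreserving_sub_right volume a'))
  have hRa : ∀ z, ‖R z - a‖ = ‖z - a'‖ := fun z => by
    simp only [hR, add_sub_cancel_left, LinearIsometryEquiv.norm_map]
  have hRa' : ∀ z, ‖R z - a'‖ = ‖z - a‖ := fun z => by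
    have h1 : L (a' - a) = -(a' - a) :=
      Submodule.reflection_orthogonalComplement_singleton_eq_neg _
    have h2 : R z - a' = L ((z - a') + (a' - a)) := by
      rw [map_add, h1]; simp only [hR]; abel
    rw [h2, LinearIsometryEquiv.norm_map]; congr 1; abel
  have key : (volume.withDensity f) (B' \ B) ≤ (volume.withDensity f) (B \ B') := by
    rw [withDensity_apply _ (mB'.diff mB), withDensity_apply _ (mB.diff mB'),
      ← hRmp.setLIntegral_comp_preimage (mB.diff mB') hf]
    have hpre : R ⁻¹' (B \ B') = B' \ B := by
      ext z
      simp [hB, hB', hRa, hRa']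
    rw [hpre]
    refine setLIntegral_mono' (mB'.diff mB) fun z hz => hmono _ _ ?_
    refine reflect_norm_le a a' z h ?_
    simp only [hB, hB', Set.mem_sdiff, Set.mem_ofPred_eq, not_le] at hz
    linarith [hz.1, hz.2]
  rw [← measure_inter_add_sdiff B' mB, ← measure_inter_add_sdiff B mB', Set.inter_comm]
  gcongr

/-- Stochastic dominance of shifted Gaussian norms: if `X` is a centered 2D
Gaussian with parameter `σ` and `‖s‖ ≤ ‖s'‖`, then `‖X + s‖` is stochastically dominated by
`‖X + s'‖`: for every `r ≥ 0`, `P(‖X + s'‖ ≤ r) ≤ P(‖X + s‖ ≤ r)`. -/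
theorem stmt_7 {Ω : Type*} [MeasureSpace Ω] [IsProbabilityMeasure (ℙ : Measure Ω)]
    (σ : ℝ) (hσ : 0 < σ)
    (X : Ω → EuclideanSpace ℝ (Fin 2)) (hX : IsCenteredGaussian2D σ X)
    (s s' : EuclideanSpace ℝ (Fin 2)) (hss' : ‖s‖ ≤ ‖s'‖) :
    ∀ r : ℝ, 0 ≤ r → ℙ {ω | ‖X ω + s'‖ ≤ r} ≤ ℙ {ω | ‖X ω + s‖ ≤ r} := by
  intro r _
  obtain ⟨hmap, hind⟩ := hX
  set v : NNReal := ⟨σ ^ 2, sq_nonneg σ⟩ with hv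
  have hv0 : v ≠ 0 := by
    intro h0
    have : (v : ℝ) = 0 := by rw [h0]; rfl
    have h2 : σ ^ 2 = 0 := this
    have : 0 < σ ^ 2 := by positivity
    linarith
  have hae : ∀ i : Fin 2, AEMeasurable (fun ω => X ω i) ℙ := fun i => by
    apply AEMeasurable.of_map_ne_zero
    rw [hmap i]
    exact IsProbabilityMeasure.ne_zero _
  let g : ℝ → ENNReal := gaussianPDF 0 v
  have hg : Measurable g := measurable_gaussianPDF 0 v
  have hprod : Measure.map (fun ω => (X ω 0, X ω 1)) ℙ
      = (volume : Measure (ℝ × ℝ)).withDensity (fun p => g p.1 * g p.2) := by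
    rw [(indepFun_iff_map_prod_eq_prod_map_map (hae 0) (hae 1)).mp hind, hmap 0, hmap 1,
      gaussianReal_of_var_ne_zero 0 hv0, prod_withDensity hg hg]
    rfl
  let f : EuclideanSpace ℝ (Fin 2) → ENNReal := fun z => g (z 0) * g (z 1)
  have hf : Measurable f := by
    exact (hg.comp (by fun_prop)).mul (hg.comp (by fun_prop))
  let T : EuclideanSpace ℝ (Fin 2) → ℝ × ℝ := fun z => (z 0, z 1)
  have hT : MeasurePreserving T volume volume :=
    (volume_preserving_finTwoArrow ℝ).comp (PiLp.volume_preserving_ofLp (Fin 2))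
  have hXae : AEMeasurable (fun ω => (X ω 0, X ω 1)) ℙ := (hae 0).prodMk (hae 1)
  have hlaw : ∀ t : EuclideanSpace ℝ (Fin 2), ℙ {ω | ‖X ω + t‖ ≤ r}
      = (volume.withDensity f) {z | ‖z - (-t)‖ ≤ r} := by
    intro t
    let S : Set (ℝ × ℝ) := {p | √((p.1 + t 0) ^ 2 + (p.2 + t 1) ^ 2) ≤ r}
    have mS : MeasurableSet S := measurableSet_le (by fun_prop) (by fun_prop)
    have h1 : {ω | ‖X ω + t‖ ≤ r} = (fun ω => (X ω 0, X ω 1)) ⁻¹' S := by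
      ext ω
      simp [S, EuclideanSpace.norm_eq, Fin.sum_univ_two]
    have h2 : {z | ‖z - (-t)‖ ≤ r} = T ⁻¹' S := by
      ext z
      simp [S, T, EuclideanSpace.norm_eq, Fin.sum_univ_two]
    rw [h1, h2, ← Measure.map_apply_of_aemeasurable hXae mS, hprod, withDensity_apply _ mS,
      withDensity_apply _ (hT.measurable mS), ← hT.setLIntegral_comp_preimage mS (by fun_prop)]
  rw [hlaw s', hlaw s]
  refine main_withDensity f hf ?_ (-s) (-s') (by simpa using hss') r
  have hfe : ∀ z, f z = ENNReal.ofReal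
      ((√(2 * π * v))⁻¹ * (√(2 * π * v))⁻¹ * rexp (-‖z‖ ^ 2 / (2 * v))) := by
    intro z
    simp only [f, g, gaussianPDF, gaussianPDFReal]
    rw [← ENNReal.ofReal_mul (by positivity), EuclideanSpace.norm_sq_eq, Fin.sum_univ_two]
    congr 1
    rw [mul_mul_mul_comm, ← Real.exp_add]
    congr 2
    simp only [norm_eq_abs, sq_abs, sub_zero]
    ring
  intro z w hzw
  rw [hfe, hfe]
  gcongr
end

section
/- Let σ > 0, let X be a centered 2D Gaussian random vector with parameter σ, let U be a nonnegative real random variable independent of X, and let α > 0 and β > 0. Then for all s, s' ∈ ℝ² with ‖s‖ ≤ ‖s'‖, P(U·‖X + s‖^{−α} > β) ≥ P(U·‖X + s'‖^{−α} > β). In particular, among serving devices at distances t₁ ≤ t₂ ≤ … ≤ t_N from the cluster center, the coverage probability of a receiver whose position relative to the cluster center is X is maximized by serving from the device closest to the cluster center. -/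
open MeasureTheory ProbabilityTheory Real

/-- Formula for the probability that `U` exceeds a function of an integer-valued variable
independent of `U`; `U` need not be measurable. -/
lemma aux_discrete {Ω : Type*} [MeasurableSpace Ω] (μ : Measure Ω)
    (U : Ω → ℝ) (K : Ω → ℕ) (hK : Measurable K) (h : IndepFun U K μ) (g : ℕ → ℝ) :
    μ {ω | g (K ω) < U ω} = ∫⁻ k, μ {ω | g k < U ω} ∂(μ.map K) := by
  set E := {ω | g (K ω) < U ω} with hE
  have h1 : μ E = ∑' k, (μ.restrict E) (K ⁻¹' {k}) := by
    rw [← measure_iUnion]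
    · have hun : (⋃ i, K ⁻¹' {i}) = Set.univ := by ext ω; simp
      rw [hun, Measure.restrict_apply_univ]
    · intro i j hij
      exact Disjoint.preimage _ (by simpa using hij)
    · intro i; exact hK (measurableSet_singleton i)
  rw [h1, lintegral_countable']
  congr 1
  ext k
  rw [Measure.restrict_apply (hK (measurableSet_singleton k)),
    Measure.map_apply hK (measurableSet_singleton k)]
  have : K ⁻¹' {k} ∩ E = U ⁻¹' (Set.Ioi (g k)) ∩ K ⁻¹' {k} := by
    ext ω
    simp only [Set.mem_inter_iff, Set.mem_preimage, Set.mem_singleton_iff, hE, Set.mem_ofPred_eq,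
      Set.mem_Ioi]
    constructor
    · rintro ⟨rfl, h⟩; exact ⟨h, rfl⟩
    · rintro ⟨h, rfl⟩; exact ⟨rfl, h⟩
  rw [this, h.measure_inter_preimage_eq_mul _ _ measurableSet_Ioi (measurableSet_singleton k)]
  rfl

lemma aux_dom (ν ν' : Measure ℕ) (huniv : ν' Set.univ ≤ ν Set.univ)
    (h : ∀ m, ν' (Set.Iio m) ≤ ν (Set.Iio m)) (G : ℕ → ENNReal) (hG : Antitone G)
    (hG1 : ∀ k, G k ≠ ⊤) : ∫⁻ k, G k ∂ν' ≤ ∫⁻ k, G k ∂ν := by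
  have e : G = fun k => ENNReal.ofReal ((G k).toReal) := by
    ext k; rw [ENNReal.ofReal_toReal (hG1 k)]
  rw [e]
  rw [lintegral_eq_lintegral_meas_lt ν' (Filter.Eventually.of_forall fun _ => by simp)
    (measurable_of_countable _).aemeasurable,
    lintegral_eq_lintegral_meas_lt ν (Filter.Eventually.of_forall fun _ => by simp)
    (measurable_of_countable _).aemeasurable]
  refine lintegral_mono fun t => ?_
  by_cases hall : ∀ k, t < (G k).toReal
  · simpa [hall] using huniv
  · push Not at hall
    classical
    have : {a | t < (G a).toReal} = Set.Iio (Nat.find hall) := by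
      ext a
      simp only [Set.mem_ofPred_eq, Set.mem_Iio, Nat.lt_find_iff, not_le]
      constructor
      · intro ha m hm
        exact ha.trans_le (ENNReal.toReal_mono (hG1 m) (hG hm))
      · intro ha; exact ha a le_rfl
    rw [this]; exact h _

lemma aux_outer {Ω : Type*} [MeasurableSpace Ω] (μ : Measure Ω) [IsProbabilityMeasure μ]
    (U T T' : Ω → ℝ) (hT : Measurable T) (hT' : Measurable T') (h0 : ∀ ω, 0 ≤ T ω)
    (h0' : ∀ ω, 0 ≤ T' ω) (hi : IndepFun U T μ) (hi' : IndepFun U T' μ)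
    (h : ∀ r, μ {ω | T' ω < r} ≤ μ {ω | T ω < r}) :
    μ {ω | T' ω < U ω} ≤ μ {ω | T ω < U ω} := by
  have meas : ∀ n : ℕ, Measurable (fun x : ℝ => ⌊2 ^ n * x⌋₊) := fun n =>
    Nat.measurable_floor.comp (measurable_const_mul _)
  have key : ∀ n : ℕ, μ {ω | ((⌊2 ^ n * T' ω⌋₊ : ℝ) + 1) / 2 ^ n < U ω}
      ≤ μ {ω | ((⌊2 ^ n * T ω⌋₊ : ℝ) + 1) / 2 ^ n < U ω} := by
    intro n
    have a1 := aux_discrete μ U (fun ω => ⌊2 ^ n * T ω⌋₊) ((meas n).comp hT)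
      (hi.comp measurable_id (meas n)) (fun k => ((k : ℝ) + 1) / 2 ^ n)
    have a2 := aux_discrete μ U (fun ω => ⌊2 ^ n * T' ω⌋₊) ((meas n).comp hT')
      (hi'.comp measurable_id (meas n)) (fun k => ((k : ℝ) + 1) / 2 ^ n)
    have hm1 : Measurable (fun ω => ⌊2 ^ n * T ω⌋₊) := (meas n).comp hT
    have hm2 : Measurable (fun ω => ⌊2 ^ n * T' ω⌋₊) := (meas n).comp hT'
    rw [a1, a2]
    apply aux_dom
    · rw [Measure.map_apply hm2 MeasurableSet.univ,
        Measure.map_apply hm1 MeasurableSet.univ]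
      simp
    · intro m
      rw [Measure.map_apply hm2 measurableSet_Iio,
        Measure.map_apply hm1 measurableSet_Iio]
      have e : ∀ (S : Ω → ℝ), (∀ ω, 0 ≤ S ω) →
          (fun ω => ⌊2 ^ n * S ω⌋₊) ⁻¹' Set.Iio m = {ω | S ω < m / 2 ^ n} := by
        intro S hS
        ext ω
        have : 0 ≤ 2 ^ n * S ω := mul_nonneg (by positivity) (hS ω)
        simp only [Set.mem_preimage, Set.mem_Iio, Set.mem_ofPred_eq]
        rw [Nat.floor_lt this, lt_div_iff₀ (by positivity), mul_comm]
      rw [e T h0, e T' h0']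
      exact h _
    · intro i j hij
      refine measure_mono fun ω hω => ?_
      simp only [Set.mem_ofPred_eq] at hω ⊢
      refine lt_of_le_of_lt ?_ hω
      gcongr
    · intro k; exact measure_ne_top _ _
  have un : ∀ (S : Ω → ℝ), (∀ ω, 0 ≤ S ω) → μ {ω | S ω < U ω}
      = ⨆ n : ℕ, μ {ω | ((⌊2 ^ n * S ω⌋₊ : ℝ) + 1) / 2 ^ n < U ω} := by
    intro S hS
    rw [← Monotone.measure_iUnion]
    · congr 1
      ext ω
      simp only [Set.mem_ofPred_eq, Set.mem_iUnion]
      constructor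
      · intro hω
        obtain ⟨n, hn⟩ := exists_pow_lt_of_lt_one (sub_pos.2 hω) (by norm_num : (1 / 2 : ℝ) < 1)
        refine ⟨n, ?_⟩
        rw [div_pow, one_pow] at hn
        have hf : (⌊2 ^ n * S ω⌋₊ : ℝ) ≤ 2 ^ n * S ω :=
          Nat.floor_le (mul_nonneg (by positivity) (hS ω))
        calc ((⌊2 ^ n * S ω⌋₊ : ℝ) + 1) / 2 ^ n ≤ (2 ^ n * S ω + 1) / 2 ^ n := by gcongr
          _ = S ω + 1 / 2 ^ n := by field_simp
          _ < U ω := by linarith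
      · rintro ⟨n, hn⟩
        refine lt_of_le_of_lt ?_ hn
        rw [le_div_iff₀ (by positivity), mul_comm]
        exact (Nat.lt_floor_add_one _).le
    · refine monotone_nat_of_le_succ fun n ω hω => ?_
      simp only [Set.mem_ofPred_eq] at hω ⊢
      refine lt_of_le_of_lt ?_ hω
      have hp : (0 : ℝ) < 2 ^ n := by positivity
      rw [div_le_div_iff₀ (by positivity) hp]
      have hnn : 0 ≤ 2 ^ n * S ω := mul_nonneg (by positivity) (hS ω)
      have hlt : ⌊2 ^ (n + 1) * S ω⌋₊ < 2 * (⌊2 ^ n * S ω⌋₊ + 1) := by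
        rw [Nat.floor_lt (mul_nonneg (by positivity) (hS ω))]
        have := Nat.lt_floor_add_one (2 ^ n * S ω)
        push_cast
        rw [pow_succ]; linarith
      have hlt2 : (⌊2 ^ (n + 1) * S ω⌋₊ : ℝ) + 1 ≤ 2 * (⌊2 ^ n * S ω⌋₊ + 1) := by
        exact_mod_cast hlt
      calc _ ≤ (2 * ((⌊2 ^ n * S ω⌋₊ : ℝ) + 1)) * 2 ^ n := by gcongr
        _ = _ := by rw [pow_succ]; ring
  rw [un T h0, un T' h0']
  exact iSup_mono key

/-- A radially nonincreasing density gives more mass to balls with center closer to `0`. -/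
lemma aux_ball (f : EuclideanSpace ℝ (Fin 2) → ENNReal) (hf : Measurable f)
    (hmono : ∀ x y, ‖x‖ ≤ ‖y‖ → f y ≤ f x) (a b : EuclideanSpace ℝ (Fin 2))
    (hab : ‖a‖ ≤ ‖b‖) (r : ℝ) :
    ∫⁻ x in Metric.ball b r, f x ≤ ∫⁻ x in Metric.ball a r, f x := by
  rcases eq_or_ne a b with rfl | hne
  · exact le_rfl
  set u := b - a with hu
  have hu0 : u ≠ 0 := sub_ne_zero.2 hne.symm
  set m : EuclideanSpace ℝ (Fin 2) := (1 / 2 : ℝ) • (a + b) with hm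
  set L := (Submodule.span ℝ {u})ᗮ.reflection with hL
  have hLu : L u = -u := Submodule.reflection_orthogonalComplement_singleton_eq_neg u
  have mp : MeasurePreserving (fun x => L (x - m) + m)
      (volume : Measure (EuclideanSpace ℝ (Fin 2))) volume := by
    have := (measurePreserving_add_right volume m).comp
      ((LinearIsometryEquiv.measurePreserving L).comp
        (measurePreserving_sub_right (volume : Measure (EuclideanSpace ℝ (Fin 2))) m))
    exact this
  have da : ∀ x, dist (L (x - m) + m) a = dist x b := by
    intro x
    rw [dist_eq_norm, dist_eq_norm, ← L.norm_map (x - b)]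
    congr 1
    have e1 : x - b = (x - m) - (1 / 2 : ℝ) • u := by rw [hm, hu]; module
    have e2 : L (x - b) = L (x - m) + (1 / 2 : ℝ) • u := by
      rw [e1, map_sub L (x - m), map_smul, hLu]; module
    rw [e2, hm, hu]; module
  have db : ∀ x, dist (L (x - m) + m) b = dist x a := by
    intro x
    rw [dist_eq_norm, dist_eq_norm, ← L.norm_map (x - a)]
    congr 1
    have e1 : x - a = (x - m) + (1 / 2 : ℝ) • u := by rw [hm, hu]; module
    have e2 : L (x - a) = L (x - m) - (1 / 2 : ℝ) • u := by
      rw [e1, map_add L (x - m), map_smul, hLu]; module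
    rw [e2, hm, hu]; module
  have pre : (fun x => L (x - m) + m) ⁻¹' (Metric.ball a r \ Metric.ball b r)
      = Metric.ball b r \ Metric.ball a r := by
    ext x
    simp only [Set.mem_preimage, Set.mem_sdiff, Metric.mem_ball, da, db]
  have hnorm : ∀ x ∈ Metric.ball b r \ Metric.ball a r, ‖L (x - m) + m‖ ≤ ‖x‖ := by
    intro x hx
    have hd : ‖x - b‖ ≤ ‖x - a‖ := by
      have h1 := hx.1
      have h2 := hx.2
      rw [Metric.mem_ball, dist_eq_norm] at h1 h2
      linarith
    have hupos : 0 < ‖u‖ ^ 2 := by positivity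
    have e : L (x - m) + m = x - (2 * (inner ℝ u (x - m) / ‖u‖ ^ 2)) • u := by
      rw [hL, Submodule.reflection_orthogonal_apply, Submodule.reflection_singleton_apply]
      simp only [RCLike.ofReal_real_eq_id, id]
      module
    have i1 : 0 ≤ inner ℝ u (x - m) := by
      have q : ‖x - b‖ ^ 2 ≤ ‖x - a‖ ^ 2 := by gcongr
      rw [show x - b = (x - m) - (1 / 2 : ℝ) • u by rw [hm, hu]; module,
        show x - a = (x - m) + (1 / 2 : ℝ) • u by rw [hm, hu]; module,
        norm_sub_sq_real, norm_add_sq_real, inner_smul_right, real_inner_comm] at q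
      linarith
    have i2 : 0 ≤ inner ℝ u m := by
      have q : ‖a‖ ^ 2 ≤ ‖b‖ ^ 2 := by gcongr
      rw [show a = m - (1 / 2 : ℝ) • u by rw [hm, hu]; module,
        show b = m + (1 / 2 : ℝ) • u by rw [hm, hu]; module,
        norm_sub_sq_real, norm_add_sq_real, inner_smul_right, real_inner_comm] at q
      linarith
    have i3 : inner ℝ u x = inner ℝ u (x - m) + inner ℝ u m := by
      rw [← inner_add_right]; simp
    have sq : ‖L (x - m) + m‖ ^ 2 ≤ ‖x‖ ^ 2 := by
      rw [e, norm_sub_sq_real, inner_smul_right, real_inner_comm u x, i3, norm_smul, mul_pow,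
        Real.norm_eq_abs, sq_abs]
      set p := inner ℝ u (x - m)
      set q := inner ℝ u m
      have : ‖x‖ ^ 2 - 2 * (2 * (p / ‖u‖ ^ 2) * (p + q)) + (2 * (p / ‖u‖ ^ 2)) ^ 2 * ‖u‖ ^ 2
          = ‖x‖ ^ 2 - 4 * (p * q / ‖u‖ ^ 2) := by
        field_simp; ring
      rw [this]
      have : 0 ≤ p * q / ‖u‖ ^ 2 := by positivity
      linarith
    exact le_of_sq_le_sq sq (norm_nonneg _)
  rw [← lintegral_inter_add_sdiff f (Metric.ball b r) (measurableSet_ball (x := a) (ε := r)),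
    ← lintegral_inter_add_sdiff f (Metric.ball a r) (measurableSet_ball (x := b) (ε := r)),
    Set.inter_comm]
  refine add_le_add le_rfl ?_
  rw [← mp.setLIntegral_comp_preimage
    (s := Metric.ball a r \ Metric.ball b r) (measurableSet_ball.diff measurableSet_ball) hf, pre]
  exact setLIntegral_mono' (measurableSet_ball.diff measurableSet_ball)
    fun x hx => hmono _ _ (hnorm x hx)

lemma aux_law {Ω : Type*} [MeasurableSpace Ω] (μ : Measure Ω) [IsProbabilityMeasure μ]
    (v : NNReal) (hv : v ≠ 0) (X : Ω → EuclideanSpace ℝ (Fin 2)) (hX : Measurable X)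
    (hl : ∀ i, μ.map (fun ω => X ω i) = gaussianReal 0 v)
    (hi : IndepFun (fun ω => X ω 0) (fun ω => X ω 1) μ)
    (B : Set (EuclideanSpace ℝ (Fin 2))) (hB : MeasurableSet B) :
    μ (X ⁻¹' B) = ∫⁻ x in B, gaussianPDF 0 v (x 0) * gaussianPDF 0 v (x 1) := by
  have hc : ∀ i, Measurable (fun ω => X ω i) := fun i => by fun_prop
  have h1 := (indepFun_iff_map_prod_eq_prod_map_map (hc 0).aemeasurable (hc 1).aemeasurable).1 hi
  rw [hl, hl, gaussianReal_of_var_ne_zero _ hv,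
    prod_withDensity (measurable_gaussianPDF _ _) (measurable_gaussianPDF _ _)] at h1
  have mp : MeasurePreserving (fun x : EuclideanSpace ℝ (Fin 2) => (x 0, x 1))
      volume (volume : Measure (ℝ × ℝ)) :=
    (volume_preserving_finTwoArrow ℝ).comp
      (EuclideanSpace.volume_preserving_symm_measurableEquiv_toLp (Fin 2))
  let e : ℝ × ℝ → EuclideanSpace ℝ (Fin 2) := fun p => !₂[p.1, p.2]
  have he : Measurable e := by
    refine (MeasurableEquiv.toLp 2 (Fin 2 → ℝ)).measurable.comp ?_
    refine measurable_pi_iff.2 fun i => ?_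
    fin_cases i
    · exact measurable_fst
    · exact measurable_snd
  have hex : ∀ x : EuclideanSpace ℝ (Fin 2), e (x 0, x 1) = x := by
    intro x; ext i; fin_cases i <;> rfl
  have hpre : X ⁻¹' B = (fun ω => (X ω 0, X ω 1)) ⁻¹' (e ⁻¹' B) := by
    ext ω; simp [hex]
  have hpre2 : (fun x : EuclideanSpace ℝ (Fin 2) => (x 0, x 1)) ⁻¹' (e ⁻¹' B) = B := by
    ext ω; simp [hex]
  rw [hpre, ← Measure.map_apply ((hc 0).prodMk (hc 1)) (he hB), h1, withDensity_apply _ (he hB)]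
  have hm : Measurable (fun z : ℝ × ℝ => gaussianPDF 0 v z.1 * gaussianPDF 0 v z.2) :=
    ((measurable_gaussianPDF _ _).comp measurable_fst).mul
      ((measurable_gaussianPDF _ _).comp measurable_snd)
  have := mp.setLIntegral_comp_preimage (he hB) hm
  rw [hpre2] at this
  exact this.symm

lemma aux_pdf (v : NNReal) (x y : EuclideanSpace ℝ (Fin 2)) (h : ‖x‖ ≤ ‖y‖) :
    gaussianPDF 0 v (y 0) * gaussianPDF 0 v (y 1)
      ≤ gaussianPDF 0 v (x 0) * gaussianPDF 0 v (x 1) := by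
  have e : ∀ z : EuclideanSpace ℝ (Fin 2), gaussianPDF 0 v (z 0) * gaussianPDF 0 v (z 1)
      = ENNReal.ofReal ((√(2 * π * v))⁻¹ ^ 2 * Real.exp (-‖z‖ ^ 2 / (2 * v))) := by
    intro z
    rw [gaussianPDF_def, ← ENNReal.ofReal_mul (gaussianPDFReal_nonneg _ _ _), gaussianPDFReal_def]
    congr 1
    simp only [sub_zero]
    rw [mul_mul_mul_comm, ← Real.exp_add, EuclideanSpace.norm_sq_eq]
    simp only [Fin.sum_univ_two, Real.norm_eq_abs, sq_abs]
    rw [sq (√(2 * π * v))⁻¹]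
    congr 2
    ring
  rw [e, e]
  gcongr

lemma aux_main {Ω : Type*} [MeasurableSpace Ω] (μ : Measure Ω) [IsProbabilityMeasure μ]
    (v : NNReal) (hv : v ≠ 0) (X : Ω → EuclideanSpace ℝ (Fin 2)) (hX : Measurable X)
    (hl : ∀ i, μ.map (fun ω => X ω i) = gaussianReal 0 v)
    (hi : IndepFun (fun ω => X ω 0) (fun ω => X ω 1) μ)
    (U : Ω → ℝ) (hUX : IndepFun U X μ)
    (α β : ℝ) (hα : 0 < α) (hβ : 0 < β) (s s' : EuclideanSpace ℝ (Fin 2)) (hs : ‖s‖ ≤ ‖s'‖) :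
    μ {ω | β < U ω * ‖X ω + s'‖ ^ (-α)} ≤ μ {ω | β < U ω * ‖X ω + s‖ ^ (-α)} := by
  have ev : ∀ t : EuclideanSpace ℝ (Fin 2), μ {ω | β < U ω * ‖X ω + t‖ ^ (-α)}
      = μ {ω | β * ‖X ω + t‖ ^ α < U ω} := by
    intro t
    have hz : ∀ᵐ ω ∂μ, X ω + t ≠ 0 := by
      have hc : Measurable (fun ω => X ω 0) := by fun_prop
      have : NullSingletonClass (gaussianReal 0 v) := nullSingletonClass_gaussianReal hv
      have h1 : μ ((fun ω => X ω 0) ⁻¹' {-t 0}) = 0 := by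
        rw [← Measure.map_apply hc (measurableSet_singleton _), hl]
        exact measure_singleton _
      rw [ae_iff]
      refine measure_mono_null (fun ω hω => ?_) h1
      simp only [ne_eq, not_not, Set.mem_ofPred_eq] at hω
      have := congrArg (fun z : EuclideanSpace ℝ (Fin 2) => z 0) hω
      simp only [PiLp.add_apply, PiLp.zero_apply] at this
      simp only [Set.mem_preimage, Set.mem_singleton_iff]
      linarith
    refine measure_congr ?_
    filter_upwards [hz] with ω hω
    have hp : 0 < ‖X ω + t‖ ^ α := Real.rpow_pos_of_pos (norm_pos_iff.2 hω) _
    apply propext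
    change β < U ω * ‖X ω + t‖ ^ (-α) ↔ β * ‖X ω + t‖ ^ α < U ω
    rw [Real.rpow_neg (norm_nonneg _), ← div_eq_mul_inv, lt_div_iff₀ hp]
  rw [ev, ev]
  have mg : ∀ t : EuclideanSpace ℝ (Fin 2), Measurable
      (fun x : EuclideanSpace ℝ (Fin 2) => β * ‖x + t‖ ^ α) := fun t => by fun_prop
  refine aux_outer μ U (fun ω => β * ‖X ω + s‖ ^ α) (fun ω => β * ‖X ω + s'‖ ^ α)
    ((mg s).comp hX) ((mg s').comp hX) (fun ω => by positivity) (fun ω => by positivity)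
    (hUX.comp measurable_id (mg s)) (hUX.comp measurable_id (mg s')) ?_
  intro r
  rcases le_or_gt r 0 with hr | hr
  · have : {ω | β * ‖X ω + s'‖ ^ α < r} = ∅ := by
      ext ω
      simp only [Set.mem_ofPred_eq, Set.mem_empty_iff_false, iff_false, not_lt]
      exact hr.trans (by positivity)
    rw [this]; simp
  have e : ∀ t : EuclideanSpace ℝ (Fin 2), {ω | β * ‖X ω + t‖ ^ α < r}
      = X ⁻¹' Metric.ball (-t) ((r / β) ^ α⁻¹) := by
    intro t
    ext ω
    simp only [Set.mem_ofPred_eq, Set.mem_preimage, Metric.mem_ball, dist_eq_norm, sub_neg_eq_add]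
    rw [Real.lt_rpow_inv_iff_of_pos (norm_nonneg _) (by positivity) hα, lt_div_iff₀ hβ, mul_comm]
  rw [e, e, aux_law μ v hv X hX hl hi _ measurableSet_ball,
    aux_law μ v hv X hX hl hi _ measurableSet_ball]
  refine aux_ball _ ?_ (fun x y h => aux_pdf v x y h) _ _ (by simpa using hs) _
  exact ((measurable_gaussianPDF _ _).comp (by fun_prop)).mul
    ((measurable_gaussianPDF _ _).comp (by fun_prop))

/-- Coverage-optimal cluster-centric placement (Lemma 1 of the paper):
if `X` is a centered 2D Gaussian with parameter `σ`, `U ≥ 0` is independent of `X`, and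
`α, β > 0`, then for `‖s‖ ≤ ‖s'‖` one has
`P(U‖X + s‖^{−α} > β) ≥ P(U‖X + s'‖^{−α} > β)`.  In particular, among serving devices at
positions `s 1, …, s N` with nondecreasing distances from the cluster center, the coverage
probability is maximized by serving from the closest one. -/
theorem stmt_8 {Ω : Type*} [MeasureSpace Ω] [IsProbabilityMeasure (ℙ : Measure Ω)]
    (σ : ℝ) (hσ : 0 < σ)
    (X : Ω → EuclideanSpace ℝ (Fin 2)) (hX : IsCenteredGaussian2D σ X)
    (U : Ω → ℝ) (hU : ∀ ω, 0 ≤ U ω)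
    (hUX : ProbabilityTheory.IndepFun U X ℙ)
    (α β : ℝ) (hα : 0 < α) (hβ : 0 < β) :
    (∀ s s' : EuclideanSpace ℝ (Fin 2), ‖s‖ ≤ ‖s'‖ →
      ℙ {ω | β < U ω * ‖X ω + s'‖ ^ (-α)} ≤ ℙ {ω | β < U ω * ‖X ω + s‖ ^ (-α)})
    ∧ (∀ (N : ℕ) (s : Fin N → EuclideanSpace ℝ (Fin 2)),
        (Monotone fun i => ‖s i‖) →
        ∀ i j : Fin N, i ≤ j →
          ℙ {ω | β < U ω * ‖X ω + s j‖ ^ (-α)} ≤ ℙ {ω | β < U ω * ‖X ω + s i‖ ^ (-α)}) := by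
  have main : ∀ s s' : EuclideanSpace ℝ (Fin 2), ‖s‖ ≤ ‖s'‖ →
      ℙ {ω | β < U ω * ‖X ω + s'‖ ^ (-α)} ≤ ℙ {ω | β < U ω * ‖X ω + s‖ ^ (-α)} := by
    intro s s' hs
    obtain ⟨hl, hi⟩ := hX
    set v : NNReal := ⟨σ ^ 2, sq_nonneg σ⟩ with hvdef
    have hv : v ≠ 0 := by
      intro h
      have h2 : σ ^ 2 = 0 := congrArg NNReal.toReal h
      have : 0 < σ ^ 2 := by positivity
      linarith
    have hae : ∀ i, AEMeasurable (fun ω => X ω i) (ℙ : Measure Ω) := by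
      intro i
      by_contra hcon
      have h1 := hl i
      rw [Measure.map_of_not_aemeasurable hcon] at h1
      exact IsProbabilityMeasure.ne_zero (gaussianReal 0 v) h1.symm
    have hXae : AEMeasurable X (ℙ : Measure Ω) := by
      have h1 : AEMeasurable (fun ω i => X ω i) (ℙ : Measure Ω) := aemeasurable_pi_iff.2 hae
      exact (MeasurableEquiv.toLp 2 (Fin 2 → ℝ)).measurable.comp_aemeasurable h1
    have heq := hXae.ae_eq_mk
    have heqi : ∀ i, (fun ω => X ω i) =ᵐ[ℙ] (fun ω => hXae.mk X ω i) := by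
      intro i
      filter_upwards [heq] with ω hω
      rw [hω]
    have hev : ∀ t : EuclideanSpace ℝ (Fin 2), ℙ {ω | β < U ω * ‖X ω + t‖ ^ (-α)}
        = ℙ {ω | β < U ω * ‖hXae.mk X ω + t‖ ^ (-α)} := by
      intro t
      refine measure_congr ?_
      filter_upwards [heq] with ω hω
      apply propext
      change β < U ω * ‖X ω + t‖ ^ (-α) ↔ β < U ω * ‖hXae.mk X ω + t‖ ^ (-α)
      rw [hω]
    rw [hev, hev]
    exact aux_main ℙ v hv _ hXae.measurable_mk
      (fun i => by rw [← Measure.map_congr (heqi i)]; exact hl i)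
      (hi.congr (heqi 0) (heqi 1)) U (hUX.congr (Filter.EventuallyEq.refl _ _) heq)
      α β hα hβ s s' hs
  exact ⟨main, fun N s hmon i j hij => main _ _ (hmon hij)⟩
end
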